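/- Let H₁, H₂ ∈ (0,1) and α > 0 satisfy α − 4H₂ + H₁ + 2 > 0 and α < 1 − H₁. Let B^{H₁} and B^{H₂} be independent fractional Brownian motions with Hurst parameters H₁ and H₂, and set S_n = Σ_{i=0}^{n−1} K(n^α B^{H₁}_i)(B^{H₂}_{i+1} − B^{H₂}_i). Then lim_{n→∞} n^{α+H₁−1} E[S_n²] = 1/(2π√2(1−H₁)). -/

import Mathlib

open MeasureTheory ProbabilityTheory Filter Topology Real

/-- The standard Gaussian kernel `K(x) = (2π)^{-1/2} e^{-x²/2}`. -/
noncomputable def K (x : ℝ) : ℝ := (Real.sqrt (2 * Real.pi))⁻¹ * Real.exp (-(x ^ 2) / 2)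

/-- Covariance function of fractional Brownian motion with Hurst parameter `H`. -/
noncomputable def RH (H t s : ℝ) : ℝ :=
  (t ^ (2 * H) + s ^ (2 * H) - |t - s| ^ (2 * H)) / 2

/-- `B` is a fractional Brownian motion with Hurst parameter `H` on `(Ω, μ)`:
a centered Gaussian process, starting from `0`, with covariance `R_H`. -/
structure IsFBM {Ω : Type*} [MeasurableSpace Ω] (μ : Measure Ω) (H : ℝ)
    (B : ℝ → Ω → ℝ) : Prop where
  meas : ∀ t : ℝ, Measurable (B t)
  zero : ∀ᵐ ω ∂μ, B 0 ω = 0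
  gaussian : ∀ (n : ℕ) (t : Fin n → ℝ) (c : Fin n → ℝ), (∀ i, 0 ≤ t i) →
    ∃ v : NNReal, μ.map (fun ω => ∑ i, c i * B (t i) ω) = gaussianReal 0 v
  cov : ∀ s t : ℝ, 0 ≤ s → 0 ≤ t → ∫ ω, B s ω * B t ω ∂μ = RH H s t


lemma aux_second_diff (p x : ℝ) (hp : 0 < p) (hp2 : p < 2) (hx : 0 ≤ x) (hx1 : x ≤ 1) :
    |(1 + x) ^ p + (1 - x) ^ p - 2| ≤ 2 * x ^ 2 := by
  have h1 : 0 ≤ 1 + x := by linarith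
  have h2 : 0 ≤ 1 - x := by linarith
  have e1 : (1 + x) ^ p = ((1 + x) ^ 2) ^ (p / 2) := by
    rw [← Real.rpow_natCast, ← Real.rpow_mul h1]; congr 1; push_cast; ring
  have e2 : (1 - x) ^ p = ((1 - x) ^ 2) ^ (p / 2) := by
    rw [← Real.rpow_natCast, ← Real.rpow_mul h2]; congr 1; push_cast; ring
  rw [abs_le]
  constructor
  · have hx2 : 0 ≤ 1 - x ^ 2 := by nlinarith
    have hA : (1 + x) ^ (p / 2) * (1 - x) ^ (p / 2) = (1 - x ^ 2) ^ (p / 2) := by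
      rw [← Real.mul_rpow h1 h2]; congr 1; ring
    have hB : 1 - x ^ 2 ≤ (1 - x ^ 2) ^ (p / 2) := by
      rcases eq_or_lt_of_le hx2 with h | h
      · rw [← h]; positivity
      · conv_lhs => rw [← Real.rpow_one (1 - x ^ 2)]
        apply Real.rpow_le_rpow_of_exponent_ge h <;> nlinarith
    have s1 : (1 + x) ^ p = ((1 + x) ^ (p / 2)) ^ 2 := by
      rw [← Real.rpow_natCast, ← Real.rpow_mul h1]; congr 1; push_cast; ring
    have s2 : (1 - x) ^ p = ((1 - x) ^ (p / 2)) ^ 2 := by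
      rw [← Real.rpow_natCast, ← Real.rpow_mul h2]; congr 1; push_cast; ring
    rw [s1, s2]
    nlinarith [sq_nonneg ((1 + x) ^ (p / 2) - (1 - x) ^ (p / 2))]
  · have b1 := rpow_one_add_le_one_add_mul_self (s := (1 + x) ^ 2 - 1) (p := p / 2)
      (by nlinarith) (by linarith) (by linarith)
    have b2 := rpow_one_add_le_one_add_mul_self (s := (1 - x) ^ 2 - 1) (p := p / 2)
      (by nlinarith) (by linarith) (by linarith)
    rw [show 1 + ((1 + x) ^ 2 - 1) = (1 + x) ^ 2 by ring, ← e1] at b1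
    rw [show 1 + ((1 - x) ^ 2 - 1) = (1 - x) ^ 2 by ring, ← e2] at b2
    nlinarith [sq_nonneg x]

lemma aux_rho (p k : ℝ) (hp : 0 < p) (hp2 : p < 2) (hk : 1 ≤ k) :
    |((k + 1) ^ p + (k - 1) ^ p - 2 * k ^ p) / 2| ≤ k ^ (p - 2) := by
  have hk0 : 0 < k := by linarith
  have hinv : 1 / k ≤ 1 := by rw [div_le_one hk0]; exact hk
  have h := aux_second_diff p (1 / k) hp hp2 (by positivity) hinv
  have e1 : (k + 1) ^ p = k ^ p * (1 + 1 / k) ^ p := by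
    rw [← Real.mul_rpow hk0.le (by positivity)]; congr 1; field_simp
  have e2 : (k - 1) ^ p = k ^ p * (1 - 1 / k) ^ p := by
    rw [← Real.mul_rpow hk0.le (by linarith)]; congr 1; field_simp
  have e3 : k ^ (p - 2) = k ^ p * (1 / k) ^ 2 := by
    rw [Real.rpow_sub hk0]; norm_num; field_simp
  rw [e1, e2, e3, show (k ^ p * (1 + 1 / k) ^ p + k ^ p * (1 - 1 / k) ^ p - 2 * k ^ p) / 2
    = k ^ p * (((1 + 1 / k) ^ p + (1 - 1 / k) ^ p - 2) / 2) by ring, abs_mul,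
    abs_of_pos (by positivity : 0 < k ^ p)]
  gcongr
  rw [abs_div, abs_two]
  linarith

lemma aux_gap (H s k : ℝ) (hH : 0 < H) (hH1 : H < 1) (hk : 0 < k) (hs : k ≤ s) :
    (2 - 2 ^ H) * k ^ H ≤ s ^ H + k ^ H - (s + k) ^ H := by
  have hs0 : 0 < s := by linarith
  have hc := Real.concaveOn_rpow hH.le hH1.le
  have hl : k / s ≤ 1 := by rw [div_le_one hs0]; exact hs
  have m1 : k ∈ Set.Ici (0:ℝ) := hk.le
  have m2 : s + k ∈ Set.Ici (0:ℝ) := (by positivity : 0 < s + k).le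
  have c1 := hc.2 m1 m2 (by linarith : 0 ≤ 1 - k / s) (by positivity : 0 ≤ k / s) (by ring)
  have c2 := hc.2 m1 m2 (by positivity : 0 ≤ k / s) (by linarith : 0 ≤ 1 - k / s) (by ring)
  simp only [smul_eq_mul] at c1 c2
  rw [show (1 - k / s) * k + k / s * (s + k) = 2 * k by field_simp; ring,
    Real.mul_rpow (by norm_num) hk.le] at c1
  rw [show k / s * k + (1 - k / s) * (s + k) = s by field_simp; ring] at c2
  nlinarith

lemma aux_det (H s k : ℝ) (hH : 0 < H) (hH1 : H < 1) (hk : 0 < k) (hs : 0 < s) :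
    (2 - 2 ^ H) / 4 * (s ^ H * k ^ H) ^ 2 ≤ (s ^ H) ^ 2 * ((s + k) ^ H) ^ 2
      - (((s ^ H) ^ 2 + ((s + k) ^ H) ^ 2 - (k ^ H) ^ 2) / 2) ^ 2 := by
  have hκ : (0:ℝ) < 2 - 2 ^ H := by
    have : (2:ℝ) ^ H < 2 ^ (1:ℝ) := Real.rpow_lt_rpow_of_exponent_lt (by norm_num) hH1
    rw [Real.rpow_one] at this; linarith
  have hba : s ^ H ≤ (s + k) ^ H := Real.rpow_le_rpow hs.le (by linarith) hH.le
  have hbc : k ^ H ≤ (s + k) ^ H := Real.rpow_le_rpow hk.le (by linarith) hH.le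
  have ha : 0 < s ^ H := by positivity
  have hc : 0 < k ^ H := by positivity
  have key : (2 - 2 ^ H) * (s ^ H * k ^ H) ≤ (s + k) ^ H * (s ^ H + k ^ H - (s + k) ^ H) := by
    rcases le_total k s with h | h
    · have := aux_gap H s k hH hH1 hk h
      calc (2 - 2 ^ H) * (s ^ H * k ^ H) = s ^ H * ((2 - 2 ^ H) * k ^ H) := by ring
        _ ≤ _ := by gcongr
    · have := aux_gap H k s hH hH1 hs h
      rw [add_comm k s] at this
      calc (2 - 2 ^ H) * (s ^ H * k ^ H) = k ^ H * ((2 - 2 ^ H) * s ^ H) := by ring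
        _ ≤ (s + k) ^ H * (k ^ H + s ^ H - (s + k) ^ H) := by gcongr
        _ = _ := by ring
  generalize s ^ H = a at *
  generalize k ^ H = c at *
  generalize (s + k) ^ H = b at *
  generalize (2 - 2 ^ H : ℝ) = κ at *
  have hg : 0 ≤ a + c - b := by
    by_contra hcon
    push Not at hcon
    have : 0 < κ * (a * c) := by positivity
    nlinarith
  have h3 : a * c ≤ (a + b - c) * (c - a + b) := by
    apply mul_le_mul <;> linarith
  have h4 : κ * (a * c) ≤ (a + b + c) * (a + c - b) := key.trans (by gcongr; linarith)
  have h5 : (κ * (a * c)) * (a * c) ≤ ((a + b + c) * (a + c - b)) * ((a + b - c) * (c - a + b)) := by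
    apply mul_le_mul h4 h3 (by positivity) (by apply mul_nonneg <;> linarith)
  nlinarith

lemma aux_sum_upper (H : ℝ) (hH : 0 < H) (hH1 : H < 1) (n : ℕ) :
    (1 - H) * ∑ i ∈ Finset.range n, ((i:ℝ) + 1) ^ (-H) ≤ (n:ℝ) ^ (1 - H) := by
  induction n with
  | zero => simp [Real.zero_rpow (by linarith : 1 - H ≠ 0)]
  | succ n ih =>
    rw [Finset.sum_range_succ, mul_add]
    have hm : (0:ℝ) < (n:ℝ) + 1 := by positivity
    have hinv : 1 / ((n:ℝ) + 1) ≤ 1 := by rw [div_le_one hm]; linarith [(Nat.cast_nonneg n : (0:ℝ) ≤ n)]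
    have b := rpow_one_add_le_one_add_mul_self (s := - (1 / ((n:ℝ) + 1))) (p := 1 - H)
      (by linarith) (by linarith) (by linarith)
    have e1 : (n:ℝ) ^ (1 - H) = ((n:ℝ) + 1) ^ (1 - H) * (1 + - (1 / ((n:ℝ) + 1))) ^ (1 - H) := by
      rw [← Real.mul_rpow hm.le (by linarith)]; congr 1; field_simp; ring
    have e2 : ((n:ℝ) + 1) ^ (-H) = ((n:ℝ) + 1) ^ (1 - H) * (1 / ((n:ℝ) + 1)) := by
      rw [show -H = (1 - H) - 1 by ring, Real.rpow_sub_one hm.ne']; ring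
    have := mul_le_mul_of_nonneg_left b (by positivity : 0 ≤ ((n:ℝ) + 1) ^ (1 - H))
    rw [← e1] at this
    push_cast
    rw [e2]
    nlinarith

lemma aux_sum_lower (H : ℝ) (hH : 0 < H) (hH1 : H < 1) (n : ℕ) :
    ((n:ℝ) + 1) ^ (1 - H) - 1 ≤ (1 - H) * ∑ i ∈ Finset.range n, ((i:ℝ) + 1) ^ (-H) := by
  induction n with
  | zero => simp
  | succ n ih =>
    rw [Finset.sum_range_succ, mul_add]
    have hm : (0:ℝ) < (n:ℝ) + 1 := by positivity
    have b := rpow_one_add_le_one_add_mul_self (s := (1 / ((n:ℝ) + 1))) (p := 1 - H)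
      (by linarith [(by positivity : 0 < 1 / ((n:ℝ) + 1))]) (by linarith) (by linarith)
    have e1 : ((n:ℝ) + 1 + 1) ^ (1 - H) = ((n:ℝ) + 1) ^ (1 - H) * (1 + (1 / ((n:ℝ) + 1))) ^ (1 - H) := by
      rw [← Real.mul_rpow hm.le (by positivity)]; congr 1; field_simp
    have e2 : ((n:ℝ) + 1) ^ (-H) = ((n:ℝ) + 1) ^ (1 - H) * (1 / ((n:ℝ) + 1)) := by
      rw [show -H = (1 - H) - 1 by ring, Real.rpow_sub_one hm.ne']; ring
    have := mul_le_mul_of_nonneg_left b (by positivity : 0 ≤ ((n:ℝ) + 1) ^ (1 - H))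
    rw [← e1] at this
    push_cast
    rw [e2]
    nlinarith

lemma gauss_exact (v : NNReal) (c : ℝ) (hc : 0 ≤ c) :
    ∫ x, Real.exp (-(c * x ^ 2)) ∂(gaussianReal 0 v) = 1 / √(1 + 2 * v * c) := by
  by_cases hv : v = 0
  · subst hv
    simp [gaussianReal_zero_var]
  · have hv' : (0:ℝ) < v := by positivity
    rw [integral_gaussianReal_eq_integral_smul hv]
    have h : ∀ x : ℝ, gaussianPDFReal 0 v x • Real.exp (-(c * x ^ 2))
        = (√(2 * π * v))⁻¹ * Real.exp (-(c + 1 / (2 * v)) * x ^ 2) := by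
      intro x
      rw [gaussianPDFReal, smul_eq_mul, mul_assoc, ← Real.exp_add]
      congr 2
      field_simp
      ring
    simp_rw [h]
    rw [integral_const_mul, integral_gaussian, ← Real.sqrt_inv, ← Real.sqrt_mul (by positivity),
      one_div (√_), ← Real.sqrt_inv]
    congr 1
    field_simp
    ring

lemma gauss_bound (v : NNReal) (hv : v ≠ 0) (a m : ℝ) (ha : 0 < a) :
    ∫ x, Real.exp (-((a * (m + x)) ^ 2) / 2) ∂(gaussianReal 0 v) ≤ 1 / (a * √v) := by
  have hv' : (0:ℝ) < v := by positivity
  rw [integral_gaussianReal_eq_integral_smul hv]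
  have hi : Integrable (fun x : ℝ => Real.exp (-(a ^ 2 / 2) * (x + m) ^ 2)) :=
    (integrable_exp_neg_mul_sq (by positivity : 0 < a ^ 2 / 2)).comp_add_right m
  calc ∫ x, gaussianPDFReal 0 v x • Real.exp (-((a * (m + x)) ^ 2) / 2)
      ≤ ∫ x, (√(2 * π * v))⁻¹ * Real.exp (-(a ^ 2 / 2) * (x + m) ^ 2) := by
        apply integral_mono_of_nonneg
        · exact ae_of_all _ fun x => by
            have := gaussianPDFReal_nonneg 0 v x
            simp only [smul_eq_mul, Pi.zero_apply]; positivity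
        · exact hi.const_mul _
        · refine ae_of_all _ fun x => ?_
          simp only [smul_eq_mul, gaussianPDFReal]
          have e : -((a * (m + x)) ^ 2) / 2 = -(a ^ 2 / 2) * (x + m) ^ 2 := by ring
          rw [e]
          gcongr
          have : Real.exp (-(x - 0) ^ 2 / (2 * v)) ≤ 1 := by
            rw [Real.exp_le_one_iff]
            apply div_nonpos_of_nonpos_of_nonneg
            · nlinarith [sq_nonneg (x - 0)]
            · positivity
          calc _ ≤ (√(2 * π * v))⁻¹ * 1 := by gcongr
            _ = _ := mul_one _
    _ = 1 / (a * √v) := by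
        rw [integral_const_mul, integral_add_right_eq_self (fun x : ℝ => Real.exp (-(a ^ 2 / 2) * x ^ 2)),
          integral_gaussian, ← Real.sqrt_inv, ← Real.sqrt_mul (by positivity)]
        have : a * √v = √(a ^ 2 * v) := by
          rw [Real.sqrt_mul (by positivity), Real.sqrt_sq ha.le]
        rw [this, one_div, ← Real.sqrt_inv]
        congr 1
        field_simp

lemma gauss_mem {Ω : Type*} [MeasurableSpace Ω] (μ : Measure Ω) (W : Ω → ℝ) (hW : Measurable W)
    (h : ∃ v : NNReal, μ.map W = gaussianReal 0 v) : MemLp W 2 μ ∧ ∫ ω, W ω ∂μ = 0 := by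
  obtain ⟨v, hv⟩ := h
  constructor
  · have := (memLp_id_gaussianReal (μ := 0) (v := v) 2)
    rw [← hv, memLp_map_measure_iff (by fun_prop) (by fun_prop)] at this
    simpa using this
  · have := integral_map (μ := μ) hW.aemeasurable (f := fun x : ℝ => x) (by fun_prop)
    rw [hv, integral_id_gaussianReal] at this
    exact this.symm

lemma gauss_var {Ω : Type*} [MeasurableSpace Ω] (μ : Measure Ω) (W : Ω → ℝ) (hW : Measurable W)
    (v : NNReal) (hv : μ.map W = gaussianReal 0 v) : ∫ ω, W ω * W ω ∂μ = v := by
  have h1 := integral_map (μ := μ) hW.aemeasurable (f := fun x : ℝ => x * x) (by fun_prop)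
  have h2 := variance_fun_id_gaussianReal (μ := 0) (v := v)
  rw [variance_eq_integral (by fun_prop), integral_id_gaussianReal] at h2
  rw [← h1, hv, ← h2]
  congr 1; ext x; ring

lemma two_bound {Ω : Type*} [MeasurableSpace Ω] (μ : Measure Ω) [IsProbabilityMeasure μ]
    (X Y : Ω → ℝ) (hX : Measurable X) (hY : Measurable Y)
    (hg : ∀ c d : ℝ, ∃ v : NNReal, μ.map (fun ω => c * X ω + d * Y ω) = gaussianReal 0 v)
    (A B R D a : ℝ) (hA : ∫ ω, X ω * X ω ∂μ = A) (hB : ∫ ω, Y ω * Y ω ∂μ = B)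
    (hR : ∫ ω, X ω * Y ω ∂μ = R) (hA0 : 0 < A) (hD : D = A * B - R ^ 2) (hD0 : 0 < D)
    (ha : 0 < a) :
    ∫ ω, Real.exp (-((a * X ω) ^ 2) / 2) * Real.exp (-((a * Y ω) ^ 2) / 2) ∂μ
      ≤ 1 / (a ^ 2 * √D) := by
  obtain ⟨vX, hvX⟩ : ∃ v : NNReal, μ.map X = gaussianReal 0 v := by simpa using hg 1 0
  have hYg : ∃ v : NNReal, μ.map Y = gaussianReal 0 v := by simpa using hg 0 1
  obtain ⟨mX, eX⟩ := gauss_mem μ X hX ⟨vX, hvX⟩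
  obtain ⟨mY, eY⟩ := gauss_mem μ Y hY hYg
  set r := R / A with hr
  set Z : Ω → ℝ := fun ω => -r * X ω + 1 * Y ω with hZdef
  have hZ : Measurable Z := by fun_prop
  obtain ⟨vZ, hvZ⟩ := hg (-r) 1
  change μ.map Z = _ at hvZ
  obtain ⟨mZ, eZ⟩ := gauss_mem μ Z hZ ⟨vZ, hvZ⟩
  have iXX : Integrable (fun ω => X ω * X ω) μ := mX.integrable_mul mX
  have iXY : Integrable (fun ω => X ω * Y ω) μ := mX.integrable_mul mY
  have iYY : Integrable (fun ω => Y ω * Y ω) μ := mY.integrable_mul mY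
  have hXZ : ∫ ω, X ω * Z ω ∂μ = 0 := by
    have : ∀ ω, X ω * Z ω = -r * (X ω * X ω) + X ω * Y ω := fun ω => by simp only [hZdef]; ring
    simp_rw [this]
    rw [integral_add (iXX.const_mul _) iXY, integral_const_mul, hA, hR, hr]
    field_simp
    ring
  have hZZ : ∫ ω, Z ω * Z ω ∂μ = D / A := by
    have : ∀ ω, Z ω * Z ω = (r ^ 2 * (X ω * X ω) + (-2 * r) * (X ω * Y ω)) + Y ω * Y ω :=
      fun ω => by simp only [hZdef]; ring
    simp_rw [this]
    have i2 : Integrable (fun ω => r ^ 2 * (X ω * X ω) + (-2 * r) * (X ω * Y ω)) μ :=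
      (iXX.const_mul _).add (iXY.const_mul _)
    rw [integral_add i2 iYY,
      integral_add (iXX.const_mul _) (iXY.const_mul _), integral_const_mul, integral_const_mul,
      hA, hR, hB, hr, hD]
    field_simp
    ring
  have hvXA : (vX : ℝ) = A := by rw [← hA, gauss_var μ X hX vX hvX]
  have hvZD : (vZ : ℝ) = D / A := by rw [← hZZ, gauss_var μ Z hZ vZ hvZ]
  have hvX0 : vX ≠ 0 := by
    intro h; rw [h] at hvXA; simp at hvXA; linarith
  have hvZ0 : vZ ≠ 0 := by
    intro h; rw [h, NNReal.coe_zero] at hvZD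
    have : 0 < D / A := by positivity
    linarith
  have hG : HasGaussianLaw (fun ω => (X ω, Z ω)) μ := by
    constructor
    apply isGaussian_of_map_eq_gaussianReal
    intro L
    obtain ⟨v, hv⟩ := hg (L (1, 0) + L (0, 1) * (-r)) (L (0, 1))
    refine ⟨0, v, ?_⟩
    rw [Measure.map_map (by fun_prop) (by fun_prop), ← hv]
    congr 1
    ext ω
    have : (X ω, Z ω) = X ω • ((1:ℝ), (0:ℝ)) + Z ω • ((0:ℝ), (1:ℝ)) := by simp
    simp only [Function.comp, this, map_add, map_smul, smul_eq_mul]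
    simp only [hZdef]; ring
  have hI : IndepFun X Z μ := by
    apply hG.indepFun_of_covariance_eq_zero
    rw [covariance_eq_sub mX mZ, eX]
    simpa using hXZ
  rw [indepFun_iff_map_prod_eq_prod_map_map hX.aemeasurable hZ.aemeasurable] at hI
  set F : ℝ × ℝ → ℝ := fun p => Real.exp (-((a * p.1) ^ 2) / 2) *
    Real.exp (-((a * (r * p.1 + p.2)) ^ 2) / 2) with hF
  have hFm : Measurable F := by fun_prop
  have exple : ∀ y : ℝ, Real.exp (-(y ^ 2) / 2) ≤ 1 := fun y => by
    rw [Real.exp_le_one_iff]; nlinarith [sq_nonneg y]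
  have e1 : ∫ ω, Real.exp (-((a * X ω) ^ 2) / 2) * Real.exp (-((a * Y ω) ^ 2) / 2) ∂μ
      = ∫ p, F p ∂(μ.map (fun ω => (X ω, Z ω))) := by
    rw [integral_map (by fun_prop) (by fun_prop)]
    congr 1; ext ω
    simp only [hF, hZdef]
    congr 4; ring
  rw [e1, hI, hvX, hvZ]
  have hFi : Integrable F ((gaussianReal 0 vX).prod (gaussianReal 0 vZ)) := by
    apply Integrable.of_bound (C := 1) hFm.aestronglyMeasurable
    refine ae_of_all _ fun p => ?_
    rw [Real.norm_of_nonneg (by simp only [hF]; positivity)]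
    simp only [hF]
    exact mul_le_one₀ (exple _) (by positivity) (exple _)
  rw [integral_prod _ hFi]
  calc ∫ x, ∫ z, F (x, z) ∂(gaussianReal 0 vZ) ∂(gaussianReal 0 vX)
      ≤ ∫ x, Real.exp (-((a * (0 + x)) ^ 2) / 2) * (1 / (a * √vZ)) ∂(gaussianReal 0 vX) := by
        apply integral_mono_of_nonneg
        · exact ae_of_all _ fun x => integral_nonneg fun z => by simp only [hF]; positivity
        · apply Integrable.mul_const
          apply Integrable.of_bound (C := 1) (by fun_prop)
          refine ae_of_all _ fun x => ?_
          rw [Real.norm_of_nonneg (by positivity)]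
          exact exple _
        · refine ae_of_all _ fun x => ?_
          simp only [hF]
          rw [integral_const_mul, zero_add]
          gcongr
          exact gauss_bound vZ hvZ0 a (r * x) ha
    _ ≤ 1 / (a * √vX) * (1 / (a * √vZ)) := by
        rw [integral_mul_const]
        gcongr
        exact gauss_bound vX hvX0 a 0 ha
    _ = 1 / (a ^ 2 * √D) := by
        rw [hvXA, hvZD, Real.sqrt_div hD0.le]
        have : 0 < √A := Real.sqrt_pos.mpr hA0
        have : 0 < √D := Real.sqrt_pos.mpr hD0
        field_simp

lemma fbm_pair {Ω : Type*} [MeasurableSpace Ω] {μ : Measure Ω} {H : ℝ} {B : ℝ → Ω → ℝ}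
    (hB : IsFBM μ H B) (s t : ℝ) (hs : 0 ≤ s) (ht : 0 ≤ t) (c d : ℝ) :
    ∃ v : NNReal, μ.map (fun ω => c * B s ω + d * B t ω) = gaussianReal 0 v := by
  have := hB.gaussian 2 ![s, t] ![c, d] (by intro i; fin_cases i <;> simpa)
  simpa [Fin.sum_univ_two] using this

lemma fbm_one {Ω : Type*} [MeasurableSpace Ω] {μ : Measure Ω} {H : ℝ} {B : ℝ → Ω → ℝ}
    (hB : IsFBM μ H B) (s : ℝ) (hs : 0 ≤ s) :
    ∃ v : NNReal, μ.map (B s) = gaussianReal 0 v := by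
  simpa using fbm_pair hB s s hs hs 1 0

lemma RH_self (H s : ℝ) (hH : 0 < H) : RH H s s = s ^ (2 * H) := by
  simp [RH, Real.zero_rpow (by linarith : 2 * H ≠ 0)]

lemma exp_sq_le_one (y : ℝ) : Real.exp (-(y ^ 2) / 2) ≤ 1 := by
  rw [Real.exp_le_one_iff]; nlinarith [sq_nonneg y]

lemma K_mul (x y : ℝ) : K x * K y
    = (2 * π)⁻¹ * (Real.exp (-(x ^ 2) / 2) * Real.exp (-(y ^ 2) / 2)) := by
  have : (√(2 * π))⁻¹ * (√(2 * π))⁻¹ = (2 * π)⁻¹ := by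
    rw [← mul_inv, Real.mul_self_sqrt (by positivity)]
  rw [K, K, ← this]; ring

lemma K_nonneg (x : ℝ) : 0 ≤ K x := by unfold K; positivity

lemma K_meas : Measurable K := by unfold K; fun_prop

lemma two_pi_inv_le : (2 * π)⁻¹ ≤ 1 := by
  apply inv_le_one_of_one_le₀; nlinarith [Real.pi_gt_three]

lemma KK_le (x y : ℝ) : K x * K y ≤ 1 := by
  rw [K_mul]
  exact mul_le_one₀ two_pi_inv_le (by positivity)
    (mul_le_one₀ (exp_sq_le_one _) (by positivity) (exp_sq_le_one _))

lemma KK_diag {Ω : Type*} [MeasurableSpace Ω] {μ : Measure Ω} {H : ℝ} (hH : 0 < H) {B : ℝ → Ω → ℝ}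
    (hB : IsFBM μ H B) (s a : ℝ) (hs : 0 ≤ s) :
    ∫ ω, K (a * B s ω) * K (a * B s ω) ∂μ
      = (2 * π)⁻¹ * (1 / √(1 + 2 * s ^ (2 * H) * a ^ 2)) := by
  obtain ⟨v, hv⟩ := fbm_one hB s hs
  have hv' := gauss_var μ _ (hB.meas s) v hv
  rw [hB.cov s s hs hs, RH_self H s hH] at hv'
  have h1 := gauss_exact v (a ^ 2) (by positivity)
  rw [← hv, integral_map (hB.meas s).aemeasurable (by fun_prop)] at h1
  rw [hv', ← h1, ← integral_const_mul]
  congr 1; ext ω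
  rw [K_mul, ← Real.exp_add]
  congr 2; ring

lemma KK_zero {Ω : Type*} [MeasurableSpace Ω] {μ : Measure Ω} [IsProbabilityMeasure μ]
    {H : ℝ} (hH : 0 < H) {B : ℝ → Ω → ℝ}
    (hB : IsFBM μ H B) (t a : ℝ) (ht : 0 < t) (ha : 0 < a) :
    ∫ ω, K (a * B 0 ω) * K (a * B t ω) ∂μ ≤ a⁻¹ * t ^ (-H) := by
  obtain ⟨v, hv⟩ := fbm_one hB t ht.le
  have hv' := gauss_var μ _ (hB.meas t) v hv
  rw [hB.cov t t ht.le ht.le, RH_self H t hH] at hv'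
  have hv0 : v ≠ 0 := by
    intro h; rw [h, NNReal.coe_zero] at hv'
    have : 0 < t ^ (2 * H) := by positivity
    linarith
  have h1 := gauss_bound v hv0 a 0 ha
  rw [← hv, integral_map (hB.meas t).aemeasurable (by fun_prop), ← hv'] at h1
  have e : 1 / (a * √(t ^ (2 * H))) = a⁻¹ * t ^ (-H) := by
    rw [Real.sqrt_eq_rpow, ← Real.rpow_mul ht.le, Real.rpow_neg ht.le,
      show 2 * H * (1 / 2) = H by ring]
    field_simp
  rw [← e]
  refine le_trans ?_ h1
  have := hB.meas t
  have := hB.meas 0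
  apply integral_mono_of_nonneg
  · exact ae_of_all _ fun ω => mul_nonneg (K_nonneg _) (K_nonneg _)
  · apply Integrable.of_bound (C := 1) (by fun_prop)
    refine ae_of_all _ fun x => ?_
    rw [Real.norm_of_nonneg (by positivity)]
    exact exp_sq_le_one _
  · refine ae_of_all _ fun ω => ?_
    simp only [K_mul, zero_add]
    rw [← mul_assoc]
    exact mul_le_of_le_one_left (by positivity) (mul_le_one₀ two_pi_inv_le (by positivity) (exp_sq_le_one _))

lemma KK_off {Ω : Type*} [MeasurableSpace Ω] {μ : Measure Ω} [IsProbabilityMeasure μ]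
    {H : ℝ} (hH : 0 < H) (hH1 : H < 1) {B : ℝ → Ω → ℝ}
    (hB : IsFBM μ H B) (s k a : ℝ) (hs : 0 < s) (hk : 0 < k) (ha : 0 < a) :
    ∫ ω, K (a * B s ω) * K (a * B (s + k) ω) ∂μ
      ≤ (1 / √((2 - 2 ^ H) / 4)) * (a ^ 2)⁻¹ * s ^ (-H) * k ^ (-H) := by
  have hκ : (0:ℝ) < (2 - 2 ^ H) / 4 := by
    have : (2:ℝ) ^ H < 2 ^ (1:ℝ) := Real.rpow_lt_rpow_of_exponent_lt (by norm_num) hH1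
    rw [Real.rpow_one] at this; linarith
  have hsk : 0 < s + k := by positivity
  have sq : ∀ x : ℝ, 0 < x → (x ^ H) ^ 2 = x ^ (2 * H) := fun x hx => by
    rw [← Real.rpow_natCast, ← Real.rpow_mul hx.le]; congr 1; push_cast; ring
  have hdet := aux_det H s k hH hH1 hk hs
  have hRHsk : RH H s (s + k) = ((s ^ H) ^ 2 + ((s + k) ^ H) ^ 2 - (k ^ H) ^ 2) / 2 := by
    rw [RH, sq s hs, sq k hk, sq _ hsk]
    congr 3
    rw [show s - (s + k) = -k by ring, abs_neg, abs_of_pos hk]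
  set D := (s ^ H) ^ 2 * ((s + k) ^ H) ^ 2
      - (((s ^ H) ^ 2 + ((s + k) ^ H) ^ 2 - (k ^ H) ^ 2) / 2) ^ 2 with hD
  have hpos : 0 < (2 - 2 ^ H) / 4 * (s ^ H * k ^ H) ^ 2 := by positivity
  have hD0 : 0 < D := hpos.trans_le hdet
  have h := two_bound μ (B s) (B (s + k)) (hB.meas _) (hB.meas _)
    (fun c d => fbm_pair hB s (s + k) hs.le hsk.le c d) ((s ^ H) ^ 2) (((s + k) ^ H) ^ 2)
    (((s ^ H) ^ 2 + ((s + k) ^ H) ^ 2 - (k ^ H) ^ 2) / 2) D a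
    (by rw [hB.cov _ _ hs.le hs.le, RH_self H s hH, sq s hs])
    (by rw [hB.cov _ _ hsk.le hsk.le, RH_self H _ hH, sq _ hsk])
    (by rw [hB.cov _ _ hs.le hsk.le, hRHsk]) (by positivity) hD hD0 ha
  simp_rw [K_mul]
  rw [integral_const_mul]
  have hnn : 0 ≤ ∫ ω, Real.exp (-((a * B s ω) ^ 2) / 2) * Real.exp (-((a * B (s + k) ω) ^ 2) / 2) ∂μ :=
    integral_nonneg fun ω => by positivity
  refine (mul_le_of_le_one_left hnn two_pi_inv_le).trans (h.trans ?_)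
  have hsq : √((2 - 2 ^ H) / 4) * (s ^ H * k ^ H) ≤ √D := by
    rw [← Real.sqrt_sq (by positivity : 0 ≤ s ^ H * k ^ H), ← Real.sqrt_mul hκ.le]
    exact Real.sqrt_le_sqrt hdet
  have hκs : 0 < √((2 - 2 ^ H) / 4) := Real.sqrt_pos.mpr hκ
  calc 1 / (a ^ 2 * √D) ≤ 1 / (a ^ 2 * (√((2 - 2 ^ H) / 4) * (s ^ H * k ^ H))) := by gcongr
    _ = _ := by
      rw [Real.rpow_neg hs.le, Real.rpow_neg hk.le]
      field_simp

lemma incr_cov {Ω : Type*} [MeasurableSpace Ω] {μ : Measure Ω}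
    {H : ℝ} {B : ℝ → Ω → ℝ}
    (hB : IsFBM μ H B) (s t : ℝ) (hs : 0 ≤ s) (ht : 0 ≤ t) :
    ∫ ω, (B (s + 1) ω - B s ω) * (B (t + 1) ω - B t ω) ∂μ
      = (|s - t + 1| ^ (2 * H) + |s - t - 1| ^ (2 * H) - 2 * |s - t| ^ (2 * H)) / 2 := by
  have m : ∀ u : ℝ, 0 ≤ u → MemLp (B u) 2 μ := fun u hu =>
    (gauss_mem μ _ (hB.meas u) (fbm_one hB u hu)).1
  have hs1 : 0 ≤ s + 1 := by linarith
  have ht1 : 0 ≤ t + 1 := by linarith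
  have i1 : Integrable (fun ω => B (s + 1) ω * B (t + 1) ω) μ := (m _ hs1).integrable_mul (m _ ht1)
  have i2 : Integrable (fun ω => B (s + 1) ω * B t ω) μ := (m _ hs1).integrable_mul (m _ ht)
  have i3 : Integrable (fun ω => B s ω * B (t + 1) ω) μ := (m _ hs).integrable_mul (m _ ht1)
  have i4 : Integrable (fun ω => B s ω * B t ω) μ := (m _ hs).integrable_mul (m _ ht)
  have : ∀ ω, (B (s + 1) ω - B s ω) * (B (t + 1) ω - B t ω)
    = (B (s + 1) ω * B (t + 1) ω - B (s + 1) ω * B t ω) - (B s ω * B (t + 1) ω - B s ω * B t ω) :=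
    fun ω => by ring
  simp_rw [this]
  have i5 : Integrable (fun ω => B (s + 1) ω * B (t + 1) ω - B (s + 1) ω * B t ω) μ := i1.sub i2
  have i6 : Integrable (fun ω => B s ω * B (t + 1) ω - B s ω * B t ω) μ := i3.sub i4
  rw [integral_sub i5 i6, integral_sub i1 i2, integral_sub i3 i4,
    hB.cov _ _ hs1 ht1, hB.cov _ _ hs1 ht, hB.cov _ _ hs ht1, hB.cov _ _ hs ht]
  simp only [RH]
  rw [show s + 1 - (t + 1) = s - t by ring, show s + 1 - t = s - t + 1 by ring,
    show s - (t + 1) = s - t - 1 by ring]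
  ring

lemma incr_diag {Ω : Type*} [MeasurableSpace Ω] {μ : Measure Ω}
    {H : ℝ} (hH : 0 < H) {B : ℝ → Ω → ℝ}
    (hB : IsFBM μ H B) (s : ℝ) (hs : 0 ≤ s) :
    ∫ ω, (B (s + 1) ω - B s ω) * (B (s + 1) ω - B s ω) ∂μ = 1 := by
  rw [incr_cov hB s s hs hs]
  simp [Real.zero_rpow (by linarith : 2 * H ≠ 0)]

lemma incr_off {Ω : Type*} [MeasurableSpace Ω] {μ : Measure Ω}
    {H : ℝ} (hH : 0 < H) (hH1 : H < 1) {B : ℝ → Ω → ℝ}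
    (hB : IsFBM μ H B) (s k : ℝ) (hs : 0 ≤ s) (hk : 1 ≤ k) :
    |∫ ω, (B (s + 1) ω - B s ω) * (B (s + k + 1) ω - B (s + k) ω) ∂μ| ≤ k ^ (2 * H - 2) := by
  rw [incr_cov hB s (s + k) hs (by linarith)]
  have h := aux_rho (2 * H) k (by linarith) (by linarith) hk
  rw [show s - (s + k) + 1 = -(k - 1) by ring, show s - (s + k) - 1 = -(k + 1) by ring,
    show s - (s + k) = -k by ring, abs_neg, abs_neg, abs_neg, abs_of_nonneg (by linarith : 0 ≤ k - 1),
    abs_of_nonneg (by linarith : 0 ≤ k + 1), abs_of_nonneg (by linarith : 0 ≤ k),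
    add_comm ((k - 1) ^ (2 * H))]
  exact h

lemma second_moment {Ω : Type*} [MeasurableSpace Ω] {μ : Measure Ω} [IsProbabilityMeasure μ]
    {H₁ H₂ : ℝ} {B₁ B₂ : ℝ → Ω → ℝ} (hB₁ : IsFBM μ H₁ B₁) (hB₂ : IsFBM μ H₂ B₂)
    (hind : Indep (⨆ t : ℝ, MeasurableSpace.comap (B₁ t) inferInstance)
        (⨆ t : ℝ, MeasurableSpace.comap (B₂ t) inferInstance) μ) (a : ℝ) (n : ℕ) :
    ∫ ω, (∑ i ∈ Finset.range n, K (a * B₁ i ω) * (B₂ ((i : ℝ) + 1) ω - B₂ i ω)) ^ 2 ∂μ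
    = ∑ i ∈ Finset.range n, ∑ j ∈ Finset.range n,
      (∫ ω, K (a * B₁ i ω) * K (a * B₁ j ω) ∂μ) *
      ∫ ω, (B₂ ((i:ℝ) + 1) ω - B₂ i ω) * (B₂ ((j:ℝ) + 1) ω - B₂ j ω) ∂μ := by
  have m : ∀ i : ℕ, MemLp (fun ω => B₂ ((i:ℝ) + 1) ω - B₂ i ω) 2 μ := fun i =>
    ((gauss_mem μ _ (hB₂.meas _) (fbm_one hB₂ ((i:ℝ) + 1) (by positivity))).1).sub
      (gauss_mem μ _ (hB₂.meas _) (fbm_one hB₂ (i:ℝ) (by positivity))).1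
  have iD : ∀ i j : ℕ, Integrable (fun ω => (B₂ ((i:ℝ) + 1) ω - B₂ i ω) *
      (B₂ ((j:ℝ) + 1) ω - B₂ j ω)) μ := fun i j => (m i).integrable_mul (m j)
  have mK : ∀ i : ℕ, Measurable (fun ω => K (a * B₁ i ω)) := fun i =>
    K_meas.comp ((hB₁.meas i).const_mul a)
  have iK : ∀ i j : ℕ, Integrable (fun ω => K (a * B₁ i ω) * K (a * B₁ j ω)) μ := fun i j => by
    apply Integrable.of_bound (C := 1) ((mK i).mul (mK j)).aestronglyMeasurable
    refine ae_of_all _ fun x => ?_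
    change ‖K (a * B₁ i x) * K (a * B₁ j x)‖ ≤ 1
    rw [Real.norm_of_nonneg (mul_nonneg (K_nonneg _) (K_nonneg _))]
    exact KK_le _ _
  have m1 : ∀ t : ℝ, Measurable[⨆ t : ℝ, MeasurableSpace.comap (B₁ t) inferInstance] (B₁ t) :=
    fun t => measurable_iff_comap_le.mpr (le_iSup (fun t : ℝ => MeasurableSpace.comap (B₁ t) inferInstance) t)
  have m2 : ∀ t : ℝ, Measurable[⨆ t : ℝ, MeasurableSpace.comap (B₂ t) inferInstance] (B₂ t) :=
    fun t => measurable_iff_comap_le.mpr (le_iSup (fun t : ℝ => MeasurableSpace.comap (B₂ t) inferInstance) t)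
  have hI : ∀ i j : ℕ, IndepFun (fun ω => K (a * B₁ i ω) * K (a * B₁ j ω))
      (fun ω => (B₂ ((i:ℝ) + 1) ω - B₂ i ω) * (B₂ ((j:ℝ) + 1) ω - B₂ j ω)) μ := by
    intro i j
    rw [IndepFun_iff_Indep]
    refine indep_of_indep_of_le_left (indep_of_indep_of_le_right hind ?_) ?_
    · apply measurable_iff_comap_le.mp
      exact ((m2 _).sub (m2 _)).mul ((m2 _).sub (m2 _))
    · apply measurable_iff_comap_le.mp
      exact (K_meas.comp ((m1 _).const_mul a)).mul (K_meas.comp ((m1 _).const_mul a))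
  have expand : ∀ ω, (∑ i ∈ Finset.range n, K (a * B₁ i ω) * (B₂ ((i : ℝ) + 1) ω - B₂ i ω)) ^ 2
      = ∑ i ∈ Finset.range n, ∑ j ∈ Finset.range n, (K (a * B₁ i ω) * K (a * B₁ j ω)) *
        ((B₂ ((i:ℝ) + 1) ω - B₂ i ω) * (B₂ ((j:ℝ) + 1) ω - B₂ j ω)) := by
    intro ω
    rw [sq, Finset.sum_mul_sum]
    refine Finset.sum_congr rfl fun i _ => Finset.sum_congr rfl fun j _ => by ring
  have iAll : ∀ i j : ℕ, Integrable (fun ω => (K (a * B₁ i ω) * K (a * B₁ j ω)) *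
        ((B₂ ((i:ℝ) + 1) ω - B₂ i ω) * (B₂ ((j:ℝ) + 1) ω - B₂ j ω))) μ := fun i j =>
    (hI i j).integrable_mul (iK i j) (iD i j)
  simp_rw [expand]
  rw [integral_finsetSum _ fun i _ => integrable_finsetSum _ fun j _ => iAll i j]
  refine Finset.sum_congr rfl fun i _ => ?_
  rw [integral_finsetSum _ fun j _ => iAll i j]
  refine Finset.sum_congr rfl fun j _ => ?_
  exact (hI i j).integral_fun_mul_eq_mul_integral (iK i j).aestronglyMeasurable
    (iD i j).aestronglyMeasurable

lemma sum_shift (q : ℕ → ℝ) (hq0 : q 0 = 0) (hq : ∀ k, 0 ≤ q k) (hs : Summable q) (i n : ℕ) :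
    ∑ j ∈ Finset.range n, q (j - i) ≤ ∑' k, q k := by
  have h : ∑ j ∈ Finset.range n, q (j - i) = ∑ k ∈ Finset.range (n - i), q k := by
    induction n with
    | zero => simp
    | succ n ih =>
      rw [Finset.sum_range_succ, ih]
      rcases le_or_gt i n with h | h
      · rw [Nat.succ_sub h, Finset.sum_range_succ]
      · rw [show n - i = 0 by omega, show n + 1 - i = 0 by omega]; simp [hq0]
  rw [h]
  exact hs.sum_le_tsum _ fun k _ => hq k

lemma T_tendsto (H : ℝ) (hH : 0 < H) (hH1 : H < 1) :
    Tendsto (fun m : ℕ => ((m:ℝ) + 1) ^ (H - 1) * ∑ i ∈ Finset.range m, ((i:ℝ) + 1) ^ (-H))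
      atTop (𝓝 (1 / (1 - H))) := by
  have hp : 0 < 1 - H := by linarith
  have hcast : Tendsto (fun m : ℕ => (m:ℝ) + 1) atTop atTop :=
    tendsto_atTop_add_const_right _ _ tendsto_natCast_atTop_atTop
  have h0 : Tendsto (fun m : ℕ => ((m:ℝ) + 1) ^ (H - 1)) atTop (𝓝 0) := by
    have := (tendsto_rpow_neg_atTop hp).comp hcast
    refine this.congr fun m => ?_
    simp only [Function.comp]; congr 1; ring
  have hl : Tendsto (fun m : ℕ => (1 - ((m:ℝ) + 1) ^ (H - 1)) * (1 / (1 - H))) atTop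
      (𝓝 (1 / (1 - H))) := by
    have := (h0.const_sub 1).mul_const (1 / (1 - H))
    simpa using this
  refine tendsto_of_tendsto_of_tendsto_of_le_of_le hl tendsto_const_nhds ?_ ?_
  · intro m
    have hm : (0:ℝ) < (m:ℝ) + 1 := by positivity
    have l := aux_sum_lower H hH hH1 m
    have e : ((m:ℝ) + 1) ^ (H - 1) * ((m:ℝ) + 1) ^ (1 - H) = 1 := by
      rw [← Real.rpow_add hm]; simp
    have l2 := mul_le_mul_of_nonneg_left l (by positivity : 0 ≤ ((m:ℝ) + 1) ^ (H - 1))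
    rw [mul_sub, e] at l2
    simp only
    rw [mul_one_div, div_le_iff₀ hp]
    linarith
  · intro m
    have hm : (0:ℝ) < (m:ℝ) + 1 := by positivity
    have l := (aux_sum_upper H hH hH1 m).trans
      (Real.rpow_le_rpow (by positivity) (by linarith : (m:ℝ) ≤ m + 1) hp.le)
    have e : ((m:ℝ) + 1) ^ (H - 1) * ((m:ℝ) + 1) ^ (1 - H) = 1 := by
      rw [← Real.rpow_add hm]; simp
    have l2 := mul_le_mul_of_nonneg_left l (by positivity : 0 ≤ ((m:ℝ) + 1) ^ (H - 1))
    rw [e] at l2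
    simp only
    rw [le_div_iff₀ hp]
    linarith

lemma diag_tendsto (H α : ℝ) (hH : 0 < H) (hH1 : H < 1) (hα : 0 < α) (h2 : α < 1 - H) :
    Tendsto (fun n : ℕ => (n:ℝ) ^ (α + H - 1) * ∑ i ∈ Finset.range n,
      (2 * π)⁻¹ * (1 / √(1 + 2 * (i:ℝ) ^ (2 * H) * ((n:ℝ) ^ α) ^ 2)))
      atTop (𝓝 (1 / (2 * π * √2 * (1 - H)))) := by
  rw [← tendsto_add_atTop_iff_nat 1]
  have hp : 0 < 1 - H := by linarith
  have hcast : Tendsto (fun m : ℕ => (m:ℝ) + 1) atTop atTop :=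
    tendsto_atTop_add_const_right _ _ tendsto_natCast_atTop_atTop
  have h0 : Tendsto (fun m : ℕ => ((m:ℝ) + 1) ^ (α + H - 1)) atTop (𝓝 0) := by
    have := (tendsto_rpow_neg_atTop (by linarith : 0 < 1 - α - H)).comp hcast
    refine this.congr fun m => ?_
    simp only [Function.comp]; congr 1; ring
  have h1 : Tendsto (fun m : ℕ => 1 / √(1 + 1 / (2 * (((m:ℝ) + 1) ^ α) ^ 2))) atTop (𝓝 1) := by
    have a1 : Tendsto (fun m : ℕ => ((m:ℝ) + 1) ^ α) atTop atTop := (tendsto_rpow_atTop hα).comp hcast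
    have a2 : Tendsto (fun m : ℕ => 2 * (((m:ℝ) + 1) ^ α) ^ 2) atTop atTop :=
      ((tendsto_pow_atTop (by norm_num : (2:ℕ) ≠ 0)).comp a1).const_mul_atTop (by norm_num)
    have a3 := a2.inv_tendsto_atTop
    have a4 := ((a3.const_add 1).sqrt).inv₀ (by simp)
    simpa using a4
  have hT := T_tendsto H hH hH1
  set T : ℕ → ℝ := fun m => ∑ i ∈ Finset.range m, ((i:ℝ) + 1) ^ (-H) with hTdef
  have hU : Tendsto (fun m : ℕ => (2 * π)⁻¹ * (((m:ℝ) + 1) ^ (α + H - 1)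
      + (1 / √2) * (((m:ℝ) + 1) ^ (H - 1) * T m))) atTop (𝓝 (1 / (2 * π * √2 * (1 - H)))) := by
    have := (h0.add (hT.const_mul (1 / √2))).const_mul (2 * π)⁻¹
    convert this using 2
    field_simp
    ring
  have hL : Tendsto (fun m : ℕ => (2 * π)⁻¹ * ((1 / √2) * (((m:ℝ) + 1) ^ (H - 1) * T m) *
      (1 / √(1 + 1 / (2 * (((m:ℝ) + 1) ^ α) ^ 2))))) atTop (𝓝 (1 / (2 * π * √2 * (1 - H)))) := by
    have := ((hT.const_mul (1 / √2)).mul h1).const_mul (2 * π)⁻¹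
    convert this using 2
    field_simp
  have key : ∀ m : ℕ, ∀ a : ℝ, a = ((m:ℝ) + 1) ^ α →
      ((m:ℝ) + 1) ^ (α + H - 1) = ((m:ℝ) + 1) ^ (H - 1) * a := by
    rintro m a rfl
    rw [← Real.rpow_add (by positivity)]; congr 1; ring
  have term : ∀ (i : ℕ) (a : ℝ), 0 < a →
      √(2 * ((i:ℝ) + 1) ^ (2 * H) * a ^ 2) = √2 * a / ((i:ℝ) + 1) ^ (-H) := by
    intro i a ha
    have hi : (0:ℝ) < (i:ℝ) + 1 := by positivity
    have e : ((i:ℝ) + 1) ^ (2 * H) = (((i:ℝ) + 1) ^ H) ^ 2 := by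
      rw [← Real.rpow_natCast, ← Real.rpow_mul hi.le]; congr 1; push_cast; ring
    rw [e, mul_assoc, ← mul_pow, Real.sqrt_mul (by norm_num), Real.sqrt_sq (by positivity),
      Real.rpow_neg hi.le]
    field_simp
  refine tendsto_of_tendsto_of_tendsto_of_le_of_le hL hU ?_ ?_
  · intro m
    simp only
    push_cast
    rw [Finset.sum_range_succ', ← Finset.mul_sum, key m _ rfl]
    set a := ((m:ℝ) + 1) ^ α with ha
    have ha0 : 0 < a := by positivity
    have hsum : (1 / √2) * T m * a⁻¹ * (1 / √(1 + 1 / (2 * a ^ 2))) ≤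
        ∑ k ∈ Finset.range m, 1 / √(1 + 2 * (((k + 1 : ℕ):ℝ)) ^ (2 * H) * a ^ 2) := by
      simp only [hTdef]
      rw [Finset.mul_sum, Finset.sum_mul, Finset.sum_mul]
      refine Finset.sum_le_sum fun k _ => ?_
      have hk : (1:ℝ) ≤ ((k:ℝ) + 1) ^ (2 * H) :=
        Real.one_le_rpow (by linarith [(Nat.cast_nonneg k : (0:ℝ) ≤ k)]) (by linarith)
      have e1 : (1 / √2) * ((k:ℝ) + 1) ^ (-H) * a⁻¹ = 1 / √(2 * ((k:ℝ) + 1) ^ (2 * H) * a ^ 2) := by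
        rw [term k a ha0]; field_simp
      rw [e1, div_mul_div_comm, one_mul, ← Real.sqrt_mul (by positivity)]
      push_cast
      apply one_div_le_one_div_of_le (by positivity)
      apply Real.sqrt_le_sqrt
      have : 2 * ((k:ℝ) + 1) ^ (2 * H) * a ^ 2 * (1 + 1 / (2 * a ^ 2))
        = ((k:ℝ) + 1) ^ (2 * H) + 2 * ((k:ℝ) + 1) ^ (2 * H) * a ^ 2 := by field_simp; ring
      rw [this]; linarith
    have hc : 0 ≤ (2 * π)⁻¹ * (((m:ℝ) + 1) ^ (H - 1) * a) := by positivity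
    have l := mul_le_mul_of_nonneg_left hsum hc
    have l3 : 0 ≤ (((m:ℝ) + 1) ^ (H - 1) * a) * ((2 * π)⁻¹ * (1 / √(1 + 2 * (((0:ℕ):ℝ)) ^ (2 * H) * a ^ 2))) := by
      positivity
    calc _ = (2 * π)⁻¹ * (((m:ℝ) + 1) ^ (H - 1) * a) * ((1 / √2) * T m * a⁻¹ * (1 / √(1 + 1 / (2 * a ^ 2)))) := by
          field_simp
      _ ≤ _ := l
      _ ≤ _ := by push_cast at l3 ⊢; linarith
  · intro m
    simp only
    push_cast
    rw [Finset.sum_range_succ', ← Finset.mul_sum, key m _ rfl]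
    set a := ((m:ℝ) + 1) ^ α with ha
    have ha0 : 0 < a := by positivity
    have hsum : 
        ∑ k ∈ Finset.range m, 1 / √(1 + 2 * (((k + 1 : ℕ):ℝ)) ^ (2 * H) * a ^ 2)
        ≤ (1 / √2) * T m * a⁻¹ := by
      simp only [hTdef]
      rw [Finset.mul_sum, Finset.sum_mul]
      refine Finset.sum_le_sum fun k _ => ?_
      have e1 : (1 / √2) * ((k:ℝ) + 1) ^ (-H) * a⁻¹ = 1 / √(2 * ((k:ℝ) + 1) ^ (2 * H) * a ^ 2) := by
        rw [term k a ha0]; field_simp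
      rw [e1]
      push_cast
      apply one_div_le_one_div_of_le (by positivity)
      apply Real.sqrt_le_sqrt
      linarith
    have hc : 0 ≤ (2 * π)⁻¹ * (((m:ℝ) + 1) ^ (H - 1) * a) := by positivity
    have l := mul_le_mul_of_nonneg_left hsum hc
    have e0 : 1 / √(1 + 2 * (((0:ℕ):ℝ)) ^ (2 * H) * a ^ 2) = 1 := by
      simp [Real.zero_rpow (by linarith : 2 * H ≠ 0)]
    rw [e0]
    have e2 : (2 * π)⁻¹ * (((m:ℝ) + 1) ^ (H - 1) * a) * ((1 / √2) * T m * a⁻¹)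
      = (2 * π)⁻¹ * ((1 / √2) * (((m:ℝ) + 1) ^ (H - 1) * T m)) := by field_simp
    rw [e2] at l
    push_cast at l ⊢
    linarith

lemma g_sum (H C a : ℝ) (hH : 0 < H) (hH1 : H < 1) (hC : 0 ≤ C) (ha : 0 < a) (g : ℕ → ℝ)
    (hg : ∀ i, g i = if i = 0 then a⁻¹ else C * (a ^ 2)⁻¹ * (i:ℝ) ^ (-H)) (n : ℕ) :
    ∑ i ∈ Finset.range n, g i ≤ a⁻¹ + C / (1 - H) * (a ^ 2)⁻¹ * (n:ℝ) ^ (1 - H) := by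
  have hp : 0 < 1 - H := by linarith
  rcases n with _ | m
  · simp [Real.zero_rpow hp.ne']; positivity
  · rw [Finset.sum_range_succ']
    have h0 : g 0 = a⁻¹ := by simp [hg]
    have h1 : ∀ k, g (k + 1) = C * (a ^ 2)⁻¹ * ((k:ℝ) + 1) ^ (-H) := fun k => by simp [hg]
    simp_rw [h1]
    rw [h0, ← Finset.mul_sum, add_comm]
    refine add_le_add le_rfl ?_
    have l := (aux_sum_upper H hH hH1 m).trans
      (Real.rpow_le_rpow (by positivity) (by linarith : (m:ℝ) ≤ m + 1) hp.le)
    rw [mul_comm, ← le_div_iff₀ hp] at l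
    calc _ ≤ C * (a ^ 2)⁻¹ * (((m:ℝ) + 1) ^ (1 - H) / (1 - H)) := by gcongr
      _ = _ := by push_cast; field_simp

theorem statement3
    {Ω : Type*} [MeasurableSpace Ω] (μ : Measure Ω) [IsProbabilityMeasure μ]
    (H₁ H₂ α : ℝ) (hH₁ : 0 < H₁) (hH₁' : H₁ < 1) (hH₂ : 0 < H₂) (hH₂' : H₂ < 1)
    (hα : 0 < α) (hcond : α - 4 * H₂ + H₁ + 2 > 0) (hcond2 : α < 1 - H₁)
    (B₁ B₂ : ℝ → Ω → ℝ) (hB₁ : IsFBM μ H₁ B₁) (hB₂ : IsFBM μ H₂ B₂)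
    (hind : Indep (⨆ t : ℝ, MeasurableSpace.comap (B₁ t) inferInstance)
        (⨆ t : ℝ, MeasurableSpace.comap (B₂ t) inferInstance) μ) :
    Tendsto (fun n : ℕ =>
        (n : ℝ) ^ (α + H₁ - 1) *
          ∫ ω, (∑ i ∈ Finset.range n,
              K ((n : ℝ) ^ α * B₁ i ω) * (B₂ ((i : ℝ) + 1) ω - B₂ i ω)) ^ 2 ∂μ)
      atTop (𝓝 (1 / (2 * Real.pi * Real.sqrt 2 * (1 - H₁)))) := by
  have hp : 0 < 1 - H₁ := by linarith
  -- exponents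
  set β := 2 - 2 * H₂ + H₁ with hβ
  have hβ0 : 0 < β := by linarith
  have hβα : 1 < β + α := by
    rcases le_total H₂ (1 / 2) with h | h <;> linarith
  obtain ⟨δ, hδ0, hδα, hδβ⟩ : ∃ δ, 0 ≤ δ ∧ δ < α ∧ 1 < β + δ := by
    refine ⟨(max 0 (1 - β) + α) / 2, ?_, ?_, ?_⟩
    · have := le_max_left 0 (1 - β); linarith
    · have : max 0 (1 - β) < α := max_lt hα (by linarith)
      linarith
    · have := le_max_right 0 (1 - β); linarith
  set q : ℕ → ℝ := fun k => (k:ℝ) ^ (-(β + δ)) with hq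
  have hq0 : q 0 = 0 := by
    simp only [hq, Nat.cast_zero]
    exact Real.zero_rpow (by linarith : -(β + δ) ≠ 0)
  have hqn : ∀ k, 0 ≤ q k := fun k => by simp only [hq]; positivity
  have hqs : Summable q := Real.summable_nat_rpow.mpr (by linarith)
  set Q := ∑' k, q k with hQ
  have hQ0 : 0 ≤ Q := tsum_nonneg hqn
  set C := 1 / √((2 - 2 ^ H₁) / 4) with hC
  have hC0 : 0 ≤ C := by positivity
  -- moments
  set G : ℕ → ℕ → ℕ → ℝ := fun n i j =>
    ∫ ω, K ((n:ℝ) ^ α * B₁ i ω) * K ((n:ℝ) ^ α * B₁ j ω) ∂μ with hG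
  set ρ : ℕ → ℕ → ℝ := fun i j =>
    ∫ ω, (B₂ ((i:ℝ) + 1) ω - B₂ i ω) * (B₂ ((j:ℝ) + 1) ω - B₂ j ω) ∂μ with hρ
  have hGs : ∀ n i j, G n i j = G n j i := fun n i j => by
    simp only [hG]; congr 1; ext ω; ring
  have hρs : ∀ i j, ρ i j = ρ j i := fun i j => by
    simp only [hρ]; congr 1; ext ω; ring
  have hGn : ∀ n i j, 0 ≤ G n i j := fun n i j =>
    integral_nonneg fun ω => mul_nonneg (K_nonneg _) (K_nonneg _)
  set g : ℕ → ℕ → ℝ := fun n i => if i = 0 then ((n:ℝ) ^ α)⁻¹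
    else C * (((n:ℝ) ^ α) ^ 2)⁻¹ * (i:ℝ) ^ (-H₁) with hg
  have hgn : ∀ n i, 0 ≤ g n i := fun n i => by simp only [hg]; split_ifs <;> positivity
  have hlt : ∀ n i j : ℕ, i < j → j < n → |G n i j * ρ i j| ≤ (n:ℝ) ^ δ * (g n i * q (j - i)) := by
    intro n i j hij hjn
    obtain ⟨k, rfl⟩ := Nat.exists_eq_add_of_lt hij
    have hk1 : i + k + 1 - i = k + 1 := by omega
    have hn0 : (0:ℝ) < n := by exact_mod_cast (by omega : 0 < n)
    have ha : 0 < (n:ℝ) ^ α := by positivity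
    have hkk : (0:ℝ) < (k:ℝ) + 1 := by positivity
    have ecast : ((i + k + 1 : ℕ) : ℝ) = (i:ℝ) + ((k:ℝ) + 1) := by push_cast; ring
    have hGb : G n i (i + k + 1) ≤ g n i * ((k:ℝ) + 1) ^ (-H₁) := by
      simp only [hG, hg, ecast]
      split_ifs with h
      · subst h
        have := KK_zero hH₁ hB₁ ((k:ℝ) + 1) ((n:ℝ) ^ α) hkk ha
        simpa using this
      · have hi : (0:ℝ) < i := by exact_mod_cast Nat.pos_of_ne_zero h
        exact KK_off hH₁ hH₁' hB₁ i ((k:ℝ) + 1) ((n:ℝ) ^ α) hi hkk ha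
    have hρb : |ρ i (i + k + 1)| ≤ ((k:ℝ) + 1) ^ (2 * H₂ - 2) := by
      simp only [hρ, ecast]
      exact incr_off hH₂ hH₂' hB₂ i ((k:ℝ) + 1) (by positivity)
        (by linarith [(Nat.cast_nonneg k : (0:ℝ) ≤ k)])
    rw [abs_mul, abs_of_nonneg (hGn _ _ _), hk1]
    calc G n i (i + k + 1) * |ρ i (i + k + 1)|
        ≤ (g n i * ((k:ℝ) + 1) ^ (-H₁)) * ((k:ℝ) + 1) ^ (2 * H₂ - 2) := by
          apply mul_le_mul hGb hρb (abs_nonneg _)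
          exact mul_nonneg (hgn _ _) (by positivity)
      _ = g n i * (((k:ℝ) + 1) ^ δ * q (k + 1)) := by
          simp only [hq]; push_cast
          rw [mul_assoc, ← Real.rpow_add hkk, ← Real.rpow_add hkk]
          congr 2; rw [hβ]; ring
      _ ≤ g n i * ((n:ℝ) ^ δ * q (k + 1)) := by
          have : (k:ℝ) + 1 ≤ n := by exact_mod_cast (by omega : k + 1 ≤ n)
          have h1 := hgn n i
          have h2 := hqn (k + 1)
          gcongr
      _ = _ := by ring
  have hne : ∀ n i j : ℕ, i < n → j < n → i ≠ j → |G n i j * ρ i j| ≤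
      (n:ℝ) ^ δ * (g n i * q (j - i) + g n j * q (i - j)) := by
    intro n i j hi hj hij
    have h1 : 0 ≤ g n i * q (j - i) := mul_nonneg (hgn _ _) (hqn _)
    have h2 : 0 ≤ g n j * q (i - j) := mul_nonneg (hgn _ _) (hqn _)
    have h3 : 0 ≤ (n:ℝ) ^ δ := by positivity
    rcases lt_or_gt_of_ne hij with h | h
    · exact (hlt n i j h hj).trans (by gcongr; linarith)
    · rw [hGs, hρs]
      exact (hlt n j i h hi).trans (by gcongr; linarith)
  set E : ℕ → ℝ := fun n => ∑ i ∈ Finset.range n, ∑ j ∈ Finset.range n, G n i j * ρ i j with hE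
  set Dg : ℕ → ℝ := fun n => ∑ i ∈ Finset.range n, G n i i with hDg
  have hoff : ∀ n : ℕ, |E n - Dg n| ≤ (n:ℝ) ^ δ * (2 * (∑ i ∈ Finset.range n, g n i) * Q) := by
    intro n
    have e : E n - Dg n = ∑ i ∈ Finset.range n, ∑ j ∈ Finset.range n,
        (if i = j then 0 else G n i j * ρ i j) := by
      simp only [hE, hDg]
      rw [← Finset.sum_sub_distrib]
      refine Finset.sum_congr rfl fun i hi => ?_
      have : G n i i = ∑ j ∈ Finset.range n, if i = j then G n i j * ρ i j else 0 := by
        rw [Finset.sum_ite_eq, if_pos hi]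
        have : ρ i i = 1 := incr_diag hH₂ hB₂ (i:ℝ) (by positivity)
        rw [this, mul_one]
      rw [this, ← Finset.sum_sub_distrib]
      refine Finset.sum_congr rfl fun j _ => ?_
      split_ifs <;> simp
    rw [e]
    have b1 : ∀ i ∈ Finset.range n, ∑ j ∈ Finset.range n, g n i * q (j - i) ≤ g n i * Q := by
      intro i _
      rw [← Finset.mul_sum]
      exact mul_le_mul_of_nonneg_left (sum_shift q hq0 hqn hqs i n) (hgn _ _)
    calc _ ≤ ∑ i ∈ Finset.range n, |∑ j ∈ Finset.range n,
            (if i = j then 0 else G n i j * ρ i j)| := Finset.abs_sum_le_sum_abs _ _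
      _ ≤ ∑ i ∈ Finset.range n, ∑ j ∈ Finset.range n,
            |(if i = j then 0 else G n i j * ρ i j)| :=
          Finset.sum_le_sum fun i _ => Finset.abs_sum_le_sum_abs _ _
      _ ≤ ∑ i ∈ Finset.range n, ∑ j ∈ Finset.range n,
            (n:ℝ) ^ δ * (g n i * q (j - i) + g n j * q (i - j)) := by
          refine Finset.sum_le_sum fun i hi => Finset.sum_le_sum fun j hj => ?_
          split_ifs with h
          · rw [abs_zero]
            exact mul_nonneg (by positivity)
              (add_nonneg (mul_nonneg (hgn _ _) (hqn _)) (mul_nonneg (hgn _ _) (hqn _)))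
          · exact hne n i j (Finset.mem_range.mp hi) (Finset.mem_range.mp hj) h
      _ = (n:ℝ) ^ δ * ((∑ i ∈ Finset.range n, ∑ j ∈ Finset.range n, g n i * q (j - i))
            + ∑ i ∈ Finset.range n, ∑ j ∈ Finset.range n, g n j * q (i - j)) := by
          rw [← Finset.sum_add_distrib, Finset.mul_sum]
          refine Finset.sum_congr rfl fun i _ => ?_
          rw [← Finset.sum_add_distrib, Finset.mul_sum]
      _ = (n:ℝ) ^ δ * ((∑ i ∈ Finset.range n, ∑ j ∈ Finset.range n, g n i * q (j - i))
            + ∑ j ∈ Finset.range n, ∑ i ∈ Finset.range n, g n j * q (i - j)) := by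
          rw [Finset.sum_comm (f := fun i j => g n j * q (i - j))]
      _ ≤ (n:ℝ) ^ δ * ((∑ i ∈ Finset.range n, g n i * Q) + ∑ i ∈ Finset.range n, g n i * Q) := by
          have h3 : 0 ≤ (n:ℝ) ^ δ := by positivity
          exact mul_le_mul_of_nonneg_left
            (add_le_add (Finset.sum_le_sum b1) (Finset.sum_le_sum b1)) h3
      _ = _ := by rw [← Finset.sum_mul]; ring
  have hdiag : Tendsto (fun n : ℕ => (n:ℝ) ^ (α + H₁ - 1) * Dg n) atTop
      (𝓝 (1 / (2 * π * √2 * (1 - H₁)))) := by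
    refine (diag_tendsto H₁ α hH₁ hH₁' hα hcond2).congr fun n => ?_
    congr 1
    refine Finset.sum_congr rfl fun i _ => ?_
    exact (KK_diag hH₁ hB₁ (i:ℝ) ((n:ℝ) ^ α) (by positivity)).symm
  have hrest : Tendsto (fun n : ℕ => (n:ℝ) ^ (α + H₁ - 1) * (E n - Dg n)) atTop (𝓝 0) := by
    have hz : Tendsto (fun n : ℕ => 2 * Q * (1 + C / (1 - H₁)) * (n:ℝ) ^ (-(α - δ))) atTop (𝓝 0) := by
      have := ((tendsto_rpow_neg_atTop (by linarith : 0 < α - δ)).comp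
        tendsto_natCast_atTop_atTop).const_mul (2 * Q * (1 + C / (1 - H₁)))
      simpa using this
    refine squeeze_zero_norm' ?_ hz
    filter_upwards [eventually_ge_atTop 1] with n hn
    have hn1 : (1:ℝ) ≤ n := by exact_mod_cast hn
    have hn0 : (0:ℝ) < n := by linarith
    have ha : 0 < (n:ℝ) ^ α := by positivity
    have hgs := g_sum H₁ C ((n:ℝ) ^ α) hH₁ hH₁' hC0 ha (g n) (fun i => rfl) n
    rw [Real.norm_eq_abs, abs_mul, abs_of_nonneg (by positivity : 0 ≤ (n:ℝ) ^ (α + H₁ - 1))]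
    have e1 : (n:ℝ) ^ (α + H₁ - 1) * ((n:ℝ) ^ α)⁻¹ = (n:ℝ) ^ (H₁ - 1) := by
      rw [← Real.rpow_neg hn0.le, ← Real.rpow_add hn0]; congr 1; ring
    have e2 : (n:ℝ) ^ (α + H₁ - 1) * ((((n:ℝ) ^ α) ^ 2)⁻¹ * (n:ℝ) ^ (1 - H₁)) = (n:ℝ) ^ (-α) := by
      rw [← Real.rpow_natCast, ← Real.rpow_mul hn0.le, ← Real.rpow_neg hn0.le,
        ← Real.rpow_add hn0, ← Real.rpow_add hn0]; congr 1; push_cast; ring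
    have e3 : (n:ℝ) ^ (H₁ - 1) ≤ (n:ℝ) ^ (-α) :=
      Real.rpow_le_rpow_of_exponent_le hn1 (by linarith)
    have e4 : (n:ℝ) ^ (-(α - δ)) = (n:ℝ) ^ δ * (n:ℝ) ^ (-α) := by
      rw [← Real.rpow_add hn0]; congr 1; ring
    calc _ ≤ (n:ℝ) ^ (α + H₁ - 1) * ((n:ℝ) ^ δ * (2 * (∑ i ∈ Finset.range n, g n i) * Q)) := by
          gcongr; exact hoff n
      _ ≤ (n:ℝ) ^ (α + H₁ - 1) * ((n:ℝ) ^ δ * (2 * (((n:ℝ) ^ α)⁻¹ +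
            C / (1 - H₁) * (((n:ℝ) ^ α) ^ 2)⁻¹ * (n:ℝ) ^ (1 - H₁)) * Q)) := by gcongr
      _ = 2 * Q * (n:ℝ) ^ δ * ((n:ℝ) ^ (α + H₁ - 1) * ((n:ℝ) ^ α)⁻¹ + C / (1 - H₁) *
            ((n:ℝ) ^ (α + H₁ - 1) * ((((n:ℝ) ^ α) ^ 2)⁻¹ * (n:ℝ) ^ (1 - H₁)))) := by ring
      _ = 2 * Q * (n:ℝ) ^ δ * ((n:ℝ) ^ (H₁ - 1) + C / (1 - H₁) * (n:ℝ) ^ (-α)) := by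
          rw [e1, e2]
      _ ≤ 2 * Q * (n:ℝ) ^ δ * ((n:ℝ) ^ (-α) + C / (1 - H₁) * (n:ℝ) ^ (-α)) := by gcongr
      _ = _ := by rw [e4]; ring
  have hfin := hdiag.add hrest
  rw [add_zero] at hfin
  refine hfin.congr fun n => ?_
  rw [second_moment hB₁ hB₂ hind]
  change _ = (n:ℝ) ^ (α + H₁ - 1) * E n
  ring
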